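/- Let s(I) denote the least integer m such that depth I^{i−1}/I^i = depth I^i/I^{i+1} for all i ≥ m, and similarly s(J) and s(I+J) (with I+J regarded as an ideal of R). Then s(I+J) ≤ s(I) + s(J) − 1. -/

import Mathlib

/-! Core definitions: depth via local cohomology at the maximal homogeneous ideal,
Castelnuovo–Mumford regularity via graded free resolutions, gradings on
subquotients of polynomial rings.  -/

open MvPolynomial

noncomputable section

namespace PaperHTT

variable (k : Type) [Field k]

/-- A polynomial is homogeneous of degree `e : ℤ` (it must vanish in negative degrees). -/
def homogZ {σ : Type} (p : MvPolynomial σ k) (e : ℤ) : Prop :=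
  p = 0 ∨ (0 ≤ e ∧ p.IsHomogeneous e.toNat)

/-- The maximal homogeneous ideal `(x_1, …, x_r)` of a polynomial ring. -/
def maxHomIdeal (σ : Type) : Ideal (MvPolynomial σ k) :=
  Ideal.span (Set.range MvPolynomial.X)

/-- The depth of a module over a polynomial ring with respect to the maximal homogeneous
ideal: the least `i` such that the `i`-th local cohomology is non-vanishing. -/
def depthM {σ : Type} (M : ModuleCat (MvPolynomial σ k)) : ℕ :=
  sInf {i : ℕ | Nontrivial ((localCohomology (maxHomIdeal k σ) i).obj M)}

/-- The subquotient `p/q` of a polynomial ring, for ideals `q ≤ p`. -/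
abbrev subQuot {σ : Type} (p q : Ideal (MvPolynomial σ k)) : Type :=
  ↥p ⧸ (Submodule.comap p.subtype q)

/-- The degree-`t` graded piece of `p/q`: the image of the homogeneous elements of
degree `t` of `p`. -/
def subQuotGr {σ : Type} (p q : Ideal (MvPolynomial σ k)) (t : ℤ) :
    AddSubgroup (subQuot k p q) :=
  AddSubgroup.closure
    {x | ∃ f : p, homogZ k (f : MvPolynomial σ k) t ∧ x = Submodule.Quotient.mk f}

/-- The degree-`t` graded piece of the quotient ring `P/Q`. -/
def quotGr {σ : Type} (Q : Ideal (MvPolynomial σ k)) (t : ℤ) :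
    AddSubgroup (MvPolynomial σ k ⧸ Q) :=
  AddSubgroup.closure {x | ∃ f, homogZ k f t ∧ x = Ideal.Quotient.mk Q f}

/-- The degree-`t` graded piece of an ideal `p`, viewed as a module. -/
def idealGr {σ : Type} (p : Ideal (MvPolynomial σ k)) (t : ℤ) : AddSubgroup ↥p :=
  AddSubgroup.closure {x : p | homogZ k (x : MvPolynomial σ k) t}

/-- A finite graded free resolution of a module `M` over a polynomial ring,
with respect to a grading `gr` of `M`: `F_i` is free of rank `rk i`, with basis elements
of (twisted) degrees `tw i l`, the differentials and augmentation are graded of degree `0`,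
and the complex `⋯ → F_1 → F_0 → M → 0` is exact. -/
structure GradedFreeRes (σ : Type) (M : Type) [AddCommGroup M]
    [Module (MvPolynomial σ k) M] (gr : ℤ → AddSubgroup M) where
  rk : ℕ → ℕ
  tw : (i : ℕ) → Fin (rk i) → ℤ
  bdd : ∃ N, ∀ i, N ≤ i → rk i = 0
  aug : (Fin (rk 0) → MvPolynomial σ k) →ₗ[MvPolynomial σ k] M
  d : (i : ℕ) →
    ((Fin (rk (i + 1)) → MvPolynomial σ k) →ₗ[MvPolynomial σ k]
      (Fin (rk i) → MvPolynomial σ k))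
  aug_surj : Function.Surjective aug
  exact_zero : LinearMap.range (d 0) = LinearMap.ker aug
  exact_succ : ∀ i, LinearMap.range (d (i + 1)) = LinearMap.ker (d i)
  aug_homog : ∀ l, aug (Pi.single l 1) ∈ gr (tw 0 l)
  d_homog : ∀ i l l', homogZ k (d i (Pi.single l 1) l') (tw (i + 1) l - tw i l')

/-- The Castelnuovo–Mumford regularity of a (finitely generated) graded module over a
polynomial ring: the least `r` such that `M` admits a graded free resolution with all
twists in homological degree `i` at most `r + i`.  (By minimal free resolutions, this
agrees with `max {aⁱ(M) + i}`.) -/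
def regM (σ : Type) (M : Type) [AddCommGroup M] [Module (MvPolynomial σ k) M]
    (gr : ℤ → AddSubgroup M) : ℤ :=
  sInf {r : ℤ | ∃ F : GradedFreeRes k σ M gr, ∀ i (l : Fin (F.rk i)), F.tw i l - (i : ℤ) ≤ r}

/-- Depth of the quotient ring `P/Q` as a module over `P`. -/
def depthQuot {σ : Type} (Q : Ideal (MvPolynomial σ k)) : ℕ :=
  depthM k (ModuleCat.of (MvPolynomial σ k) (MvPolynomial σ k ⧸ Q))

/-- Depth of the subquotient `p/q` as a module over the polynomial ring. -/
def depthSubQuot {σ : Type} (p q : Ideal (MvPolynomial σ k)) : ℕ :=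
  depthM k (ModuleCat.of (MvPolynomial σ k) (subQuot k p q))

/-- Depth of an ideal `p` as a module over the polynomial ring. -/
def depthIdeal {σ : Type} (p : Ideal (MvPolynomial σ k)) : ℕ :=
  depthM k (ModuleCat.of (MvPolynomial σ k) ↥p)

/-- Regularity of the quotient ring `P/Q`. -/
def regQuot {σ : Type} (Q : Ideal (MvPolynomial σ k)) : ℤ :=
  regM k σ (MvPolynomial σ k ⧸ Q) (quotGr k Q)

/-- Regularity of the subquotient `p/q`. -/
def regSubQuot {σ : Type} (p q : Ideal (MvPolynomial σ k)) : ℤ :=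
  regM k σ (subQuot k p q) (subQuotGr k p q)

/-- Regularity of an ideal `p`, viewed as a graded module. -/
def regIdeal {σ : Type} (p : Ideal (MvPolynomial σ k)) : ℤ :=
  regM k σ (↥p) (idealGr k p)

/-- A homogeneous ideal: one containing all homogeneous components of its elements. -/
def IsHomogeneousIdeal {σ : Type} (I : Ideal (MvPolynomial σ k)) : Prop :=
  ∀ f ∈ I, ∀ m : ℕ, MvPolynomial.homogeneousComponent m f ∈ I

/-- A monomial ideal. -/
def IsMonomialIdeal {σ : Type} (I : Ideal (MvPolynomial σ k)) : Prop :=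
  ∃ S : Set (σ →₀ ℕ), I = Ideal.span ((fun a => MvPolynomial.monomial a (1 : k)) '' S)

/-- A squarefree monomial ideal. -/
def IsSquarefreeMonomialIdeal {σ : Type} (I : Ideal (MvPolynomial σ k)) : Prop :=
  ∃ S : Set (σ →₀ ℕ), (∀ a ∈ S, ∀ x, a x ≤ 1) ∧
    I = Ideal.span ((fun a => MvPolynomial.monomial a (1 : k)) '' S)


/-- The quotient ring `P/Q` is Cohen–Macaulay: its depth equals its Krull dimension. -/
def IsCMQuot {σ : Type} (Q : Ideal (MvPolynomial σ k)) : Prop :=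
  (depthQuot k Q : WithBot (WithTop ℕ)) = ringKrullDim (MvPolynomial σ k ⧸ Q)

/-- An isomorphism of graded modules: a linear isomorphism matching up the gradings. -/
def GradedIso {P : Type} [CommRing P] {M N : Type} [AddCommGroup M] [Module P M]
    [AddCommGroup N] [Module P N] (grM : ℤ → AddSubgroup M) (grN : ℤ → AddSubgroup N) :
    Prop :=
  ∃ e : M ≃ₗ[P] N, ∀ t, (grM t).map e.toLinearMap.toAddMonoidHom = grN t

/-- `gr` is an (internal, ℤ-) grading of the module `M` over a polynomial ring,
compatible with the standard grading of the polynomial ring. -/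
def IsGrading (σ : Type) {M : Type} [AddCommGroup M] [Module (MvPolynomial σ k) M]
    (gr : ℤ → AddSubgroup M) : Prop :=
  DirectSum.IsInternal (fun t : ℤ => gr t) ∧
    ∀ (p : MvPolynomial σ k) (d : ℕ) (t : ℤ) (m : M), p.IsHomogeneous d → m ∈ gr t →
      p • m ∈ gr (t + d)

/-- The polynomial ring `A = k[x_1,…,x_r]`. -/
abbrev PA (r : ℕ) : Type := MvPolynomial (Fin r) k

/-- The polynomial ring `B = k[y_1,…,y_s]`. -/
abbrev PB (s : ℕ) : Type := MvPolynomial (Fin s) k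

/-- The polynomial ring `R = k[x_1,…,x_r,y_1,…,y_s]`. -/
abbrev PR (r s : ℕ) : Type := MvPolynomial (Fin r ⊕ Fin s) k

/-- The extension of an ideal `I ⊆ A` to `R`. -/
def extA {r s : ℕ} (I : Ideal (PA k r)) : Ideal (PR k r s) :=
  I.map (MvPolynomial.rename (Sum.inl : Fin r → Fin r ⊕ Fin s))

/-- The extension of an ideal `J ⊆ B` to `R`. -/
def extB {r s : ℕ} (J : Ideal (PB k s)) : Ideal (PR k r s) :=
  J.map (MvPolynomial.rename (Sum.inr : Fin s → Fin r ⊕ Fin s))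

/-- The ideal `I + J ⊆ R`. -/
def sumIJ {r s : ℕ} (I : Ideal (PA k r)) (J : Ideal (PB k s)) : Ideal (PR k r s) :=
  extA k I + extB k J

end PaperHTT

end

section
open CategoryTheory Limits Opposite

theorem homologyUnop_hom_naturality {V : Type*} [Category* V] [Abelian V] {ι : Type*}
    {c : ComplexShape ι}
   {K L : HomologicalComplex Vᵒᵖ c} (φ : K ⟶ L) (i : ι) :
   HomologicalComplex.homologyMap ((HomologicalComplex.unopFunctor V c).map φ.op) i ≫
       (K.homologyUnop i).hom =
   (L.homologyUnop i).hom ≫ (HomologicalComplex.homologyMap φ i).unop := by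
  apply Quiver.Hom.op_inj
  exact (HomologicalComplex.homologyOp_hom_naturality ((HomologicalComplex.unopFunctor V c).map
      φ.op) i).symm

theorem unop_conj_comp_hom {V : Type*} [Category* V] {A B C D : Vᵒᵖ} {E F : V} (a : A ≅ B)
    (b : C ≅ D)
    (m : B ⟶ D) (e : E ≅ unop B) (f : F ≅ unop D) (n : F ⟶ E)
    (h : n ≫ e.hom = f.hom ≫ m.unop) :
    (a.hom ≫ m ≫ b.inv).unop ≫ (a.unop.symm ≪≫ e.symm).hom =
      (b.unop.symm ≪≫ f.symm).hom ≫ n := by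
  rw [← Iso.eq_comp_inv] at h
  subst h
  have : a.hom.unop ≫ a.inv.unop = 𝟙 _ := by rw [← unop_comp]; simp
  simp [reassoc_of% this]

theorem isoExt_hom_naturality {R : Type} [CommRing R] {X Y : ModuleCat.{0} R} (f : X ⟶ Y)
    (P : ProjectiveResolution X) (Q : ProjectiveResolution Y) (g : P.complex ⟶ Q.complex)
    (w : g ≫ Q.π = P.π ≫ (ChainComplex.single₀ _).map f) (i : ℕ) (M : ModuleCat.{0} R) :
    ((Ext R (ModuleCat.{0} R) i).map f.op).app M ≫ (P.isoExt i M).hom =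
    (Q.isoExt i M).hom ≫ HomologicalComplex.homologyMap
      ((HomologicalComplex.unopFunctor _ _).map ((((linearYoneda R (ModuleCat R)).obj
          M).rightOp.mapHomologicalComplex _).map g).op) i := by
  have := Functor.leftDerived_map_eq ((linearYoneda R (ModuleCat R)).obj M).rightOp i f g w
  have h1 : ((Ext R (ModuleCat.{0} R) i).map f.op).app M = ((((linearYoneda R (ModuleCat R)).obj
      M).rightOp.leftDerived i).map f).unop := rfl
  have h2 := homologyUnop_hom_naturality ((((linearYoneda R (ModuleCat R)).obj
      M).rightOp.mapHomologicalComplex _).map g) i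
  rw [h1, this]
  exact unop_conj_comp_hom _ _ _ _ _ _ h2

section
variable {R : Type} [CommRing R] {ι : Type*} {c : ComplexShape ι}
    (K : HomologicalComplex (ModuleCat.{0} R) c) (i : ι)

theorem homologyπ_surjective' : Function.Surjective (K.homologyπ i) := by
  rw [← ModuleCat.epi_iff_surjective]; infer_instance

theorem exists_cycles (x : K.X i) (h : K.d i (c.next i) x = 0) : ∃ z : K.cycles i, K.iCycles i z = x
    := by
  refine ⟨(K.sc i).moduleCatCyclesIso.inv ⟨x, h⟩, ?_⟩
  exact ShortComplex.moduleCatCyclesIso_inv_iCycles_apply (K.sc i) ⟨x, h⟩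

theorem homologyπ_eq_zero_iff (z : K.cycles i) : K.homologyπ i z = 0 ↔ ∃ y, K.iCycles i z = K.d
    (c.prev i) i y := by
  constructor
  · intro h
    have : (ShortComplex.mk (K.sc i).toCycles (K.sc i).homologyπ (by simp)).Exact :=
      ShortComplex.exact_of_g_is_cokernel _ (K.sc i).homologyIsCokernel
    obtain ⟨y, hy⟩ := (ShortComplex.moduleCat_exact_iff _).1 this z h
    refine ⟨y, ?_⟩
    subst hy
    change (ConcreteCategory.hom ((K.sc i).toCycles ≫ (K.sc i).iCycles)) y = _
    simp
    rfl
  · rintro ⟨y, hy⟩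
    have : z = K.toCycles (c.prev i) i y := by
      have hm : Function.Injective (K.iCycles i) := by
        rw [← ModuleCat.mono_iff_injective]; infer_instance
      apply hm
      rw [hy]
      change _ = (ConcreteCategory.hom (K.toCycles (c.prev i) i ≫ K.iCycles i)) y
      simp
    subst this
    change (ConcreteCategory.hom (K.toCycles (c.prev i) i ≫ K.homologyπ i)) y = _
    simp
end

section
variable {R : Type} [CommRing R] (J : Ideal R)

/-- The canonical projection `R ⧸ J ^ m ⟶ R ⧸ J ^ n` for `n ≤ m`. -/
noncomputable abbrev powProj {n m : ℕ} (h : n ≤ m) : ModuleCat.of R (R ⧸ J ^ m) ⟶ ModuleCat.of R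
    (R ⧸ J ^ n) :=
  (localCohomology.ringModIdeals (localCohomology.idealPowersDiagram J)).map (X := op m) (Y := op n)
      (homOfLE h).op

/-- The cochain `φ` becomes a coboundary after pulling back along `R ⧸ J ^ m ⟶ R ⧸ J ^ n`
for some `m ≥ n`. -/
def IsEffaced {i : ℕ} {M : ModuleCat.{0} R} {n : ℕ}
    (P : ProjectiveResolution (ModuleCat.of R (R ⧸ J ^ n))) (φ : P.complex.X i ⟶ M) : Prop :=
  ∃ (m : ℕ) (h : n ≤ m) (Q : ProjectiveResolution (ModuleCat.of R (R ⧸ J ^ m)))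
    (g : Q.complex ⟶ P.complex) (j : ℕ) (ψ : Q.complex.X j ⟶ M),
    g ≫ P.π = Q.π ≫ (ChainComplex.single₀ _).map (powProj J h) ∧
      g.f i ≫ φ = Q.complex.d i j ≫ ψ

/-- Every degree `i` cocycle with values in `M` is effaced. -/
def Effaceable (i : ℕ) (M : ModuleCat.{0} R) : Prop :=
  ∀ (n : ℕ) (P : ProjectiveResolution (ModuleCat.of R (R ⧸ J ^ n))) (φ : P.complex.X i ⟶ M),
    P.complex.d (i + 1) i ≫ φ = 0 → IsEffaced J P φ

theorem iso_square_apply_eq_zero_iff {A B C D : ModuleCat.{0} R} (e : A ≅ C) (e' : B ≅ D)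
    (u : A ⟶ B) (v : C ⟶ D) (h : u ≫ e'.hom = e.hom ≫ v) (x : C) :
    u (e.inv x) = 0 ↔ v x = 0 := by
  rw [← e'.toLinearEquiv.map_eq_zero_iff]
  change (u ≫ e'.hom) (e.inv x) = 0 ↔ _
  rw [h, ← ConcreteCategory.comp_apply, Iso.inv_hom_id_assoc]

theorem ext_map_class_eq_zero_iff {X Y : ModuleCat.{0} R} (f : X ⟶ Y)
    (P : ProjectiveResolution Y) (Q : ProjectiveResolution X) (g : Q.complex ⟶ P.complex)
    (w : g ≫ P.π = Q.π ≫ (ChainComplex.single₀ _).map f) (i : ℕ) (M : ModuleCat.{0} R)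
    (z : (P.complex.linearYonedaObj R M).cycles i) :
    ((Ext R (ModuleCat.{0} R) i).map f.op).app M
        ((P.isoExt i M).inv ((P.complex.linearYonedaObj R M).homologyπ i z)) = 0 ↔
      ∃ ψ : Q.complex.X ((ComplexShape.down ℕ).symm.prev i) ⟶ M,
        g.f i ≫ (((P.complex.linearYonedaObj R M).iCycles i) z : P.complex.X i ⟶ M) =
          Q.complex.d i _ ≫ ψ := by
  let φ : P.complex.linearYonedaObj R M ⟶ Q.complex.linearYonedaObj R M :=
    (HomologicalComplex.unopFunctor _ _).map
      ((((linearYoneda R (ModuleCat R)).obj M).rightOp.mapHomologicalComplex _).map g).op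
  refine (iso_square_apply_eq_zero_iff (P.isoExt i M) (Q.isoExt i M) _
    (HomologicalComplex.homologyMap φ i) (isoExt_hom_naturality f Q P g w i M) _).trans ?_
  have h2 : HomologicalComplex.homologyMap φ i ((P.complex.linearYonedaObj R M).homologyπ i z) =
      (Q.complex.linearYonedaObj R M).homologyπ i (HomologicalComplex.cyclesMap φ i z) := by
    rw [← ConcreteCategory.comp_apply, HomologicalComplex.homologyπ_naturality,
      ConcreteCategory.comp_apply]
  rw [h2]
  refine (homologyπ_eq_zero_iff _ _ _).trans ?_
  rw [← ConcreteCategory.comp_apply, HomologicalComplex.cyclesMap_i]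
  rfl

theorem subsingleton_localCohomology_iff (i : ℕ) (M : ModuleCat.{0} R) :
    Subsingleton ((localCohomology J i).obj M) ↔ Effaceable J i M := by
  let F := localCohomology.diagram (localCohomology.idealPowersDiagram J) i ⋙ (evaluation _ _).obj M
  have e : (localCohomology J i).obj M ≅ colimit F := colimitObjIsoColimitCompEvaluation _ M
  have e' : Subsingleton ((localCohomology J i).obj M) ↔ Subsingleton (colimit F : ModuleCat R) :=
      e.toLinearEquiv.toEquiv.subsingleton_congr
  rw [e']
  constructor
  · intro hs n P φ hφ
    obtain ⟨z, hz⟩ := exists_cycles (P.complex.linearYonedaObj R M) i φ (by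
      have : (ComplexShape.up ℕ).next i = i + 1 := by simp
      change P.complex.d _ i ≫ φ = 0
      erw [this]; exact hφ)
    have h0 : colimit.ι F (op (op n)) ((P.isoExt i M).inv ((P.complex.linearYonedaObj R M).homologyπ
        i z)) = 0 := Subsingleton.elim _ _
    obtain ⟨m, f, hm⟩ := Concrete.colimit_rep_eq_zero R F _ _ h0
    have h : n ≤ m.unop.unop := f.unop.unop.le
    obtain ⟨ψ, hψ⟩ := (ext_map_class_eq_zero_iff (powProj J h) P (projectiveResolution _) _
        (ProjectiveResolution.lift_commutes _ _ _) i M z).1 hm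
    refine ⟨_, h, _, _, _, ψ, ProjectiveResolution.lift_commutes _ _ _, ?_⟩
    rw [hz] at hψ
    exact hψ
  · intro H
    refine subsingleton_of_forall_eq 0 fun x => ?_
    obtain ⟨n, y, rfl⟩ := Concrete.colimit_exists_rep F x
    let P := projectiveResolution (ModuleCat.of R (R ⧸ J ^ n.unop.unop))
    obtain ⟨z, hz⟩ := homologyπ_surjective' (P.complex.linearYonedaObj R M) i ((P.isoExt i M).hom y)
    obtain ⟨m, h, Q, g, j, ψ, w, hψ⟩ := H n.unop.unop P (((P.complex.linearYonedaObj R M).iCycles i)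
        z : _ ⟶ M) (by
      change (P.complex.linearYonedaObj R M).d i (i + 1) ((P.complex.linearYonedaObj R M).iCycles i
          z) = 0
      rw [← ConcreteCategory.comp_apply, HomologicalComplex.iCycles_d]
      rfl)
    have h4 : ∃ ψ : Q.complex.X ((ComplexShape.down ℕ).symm.prev i) ⟶ M,
        g.f i ≫ (((P.complex.linearYonedaObj R M).iCycles i) z : P.complex.X i ⟶ M)  = Q.complex.d i
            _ ≫ ψ := by
      by_cases hr : (ComplexShape.down ℕ).symm.Rel j i
      · obtain rfl := (ComplexShape.down ℕ).symm.prev_eq' hr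
        exact ⟨ψ, hψ⟩
      · refine ⟨0, ?_⟩
        rw [hψ, Q.complex.shape _ _ hr]
        simp
    have h5 := (ext_map_class_eq_zero_iff (powProj J h) P Q g w i M z).2 h4
    have h6 : (P.isoExt i M).inv ((P.complex.linearYonedaObj R M).homologyπ i z) = y :=
      (congrArg (P.isoExt i M).inv hz).trans ((P.isoExt i M).toLinearEquiv.symm_apply_apply y)
    rw [h6] at h5
    have h7 := colimit.w F (homOfLE h : n.unop.unop ⟶ m).op.op
    change colimit.ι F (op (op n.unop.unop)) y = 0
    rw [← h7, ConcreteCategory.comp_apply]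
    exact (congrArg (colimit.ι F (op (op m))) h5).trans (map_zero _)
end

end

section
open CategoryTheory Limits Opposite
variable {R : Type} [CommRing R] (J : Ideal R)

theorem powProj_comp {a b c : ℕ} (h : a ≤ b) (h' : b ≤ c) :
    powProj J h' ≫ powProj J h = powProj J (h.trans h') :=
  ((localCohomology.ringModIdeals (localCohomology.idealPowersDiagram J)).map_comp
    (X := op c) (Y := op b) (Z := op a) (homOfLE h').op (homOfLE h).op).symm

theorem powProj_refl (a : ℕ) : powProj J (le_refl a) = 𝟙 _ :=
  (localCohomology.ringModIdeals (localCohomology.idealPowersDiagram J)).map_id (op a)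

variable {J}

theorem IsEffaced.of_comp {i : ℕ} {M : ModuleCat.{0} R} {n m : ℕ} {h : n ≤ m}
    {P : ProjectiveResolution (ModuleCat.of R (R ⧸ J ^ n))} {φ : P.complex.X i ⟶ M}
    {Q : ProjectiveResolution (ModuleCat.of R (R ⧸ J ^ m))}
    {g : Q.complex ⟶ P.complex}
    (w : g ≫ P.π = Q.π ≫ (ChainComplex.single₀ _).map (powProj J h))
    (H : IsEffaced J Q (g.f i ≫ φ)) : IsEffaced J P φ := by
  obtain ⟨m', h', Q', g', j, ψ, w', hψ⟩ := H
  refine ⟨m', h.trans h', Q', g' ≫ g, j, ψ, ?_, ?_⟩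
  · rw [← powProj_comp J h h', Functor.map_comp, Category.assoc, w, reassoc_of% w']
  · rw [HomologicalComplex.comp_f, Category.assoc, hψ]

theorem IsEffaced.of_coboundary {i j : ℕ} {M : ModuleCat.{0} R} {n : ℕ}
    {P : ProjectiveResolution (ModuleCat.of R (R ⧸ J ^ n))} {φ : P.complex.X i ⟶ M}
    (ψ : P.complex.X j ⟶ M) (h : φ = P.complex.d i j ≫ ψ) : IsEffaced J P φ := by
  refine ⟨n, le_rfl, P, 𝟙 _, j, ψ, ?_, ?_⟩
  · rw [powProj_refl, CategoryTheory.Functor.map_id, Category.comp_id, Category.id_comp]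
  · simpa using h

/-- `M'` is the quotient `M / f M` and `f` is a nonzerodivisor on `M`. -/
structure IsRegQuot {M M' : Type} [AddCommGroup M] [Module R M] [AddCommGroup M'] [Module R M']
    (f : R) (p : M →ₗ[R] M') : Prop where
  reg : ∀ x : M, f • x = 0 → x = 0
  surj : Function.Surjective p
  ker : ∀ x, p x = 0 ↔ ∃ y, x = f • y

section
variable {M M' : ModuleCat.{0} R} {f : R} {p : M ⟶ M'} (hp : IsRegQuot f p.hom)
include hp

theorem IsRegQuot.smul_eq_zero : f • p = 0 := by
  ext x
  exact (map_smul p.hom f x).symm.trans ((hp.ker _).2 ⟨x, rfl⟩)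

theorem IsRegQuot.cancel {X : ModuleCat.{0} R} {α β : X ⟶ M} (h : f • α = f • β) : α = β := by
  ext x
  have : f • (α x - β x) = 0 := by
    rw [smul_sub, sub_eq_zero]
    exact congrArg (fun γ : X ⟶ M => γ x) h
  exact sub_eq_zero.1 (hp.reg _ this)

theorem IsRegQuot.pow_cancel {X : ModuleCat.{0} R} {α : X ⟶ M} (e : ℕ) (h : f ^ e • α = 0) :
    α = 0 := by
  induction e with
  | zero => simpa using h
  | succ e ih =>
    refine ih (hp.cancel ?_)
    rw [smul_smul, ← pow_succ', h, smul_zero]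

theorem IsRegQuot.divide {X : ModuleCat.{0} R} {α : X ⟶ M} (h : α ≫ p = 0) :
    ∃ β : X ⟶ M, α = f • β := by
  have h1 : ∀ x, ∃ y, α x = f • y := fun x => (hp.ker _).1 (congrArg (fun γ : X ⟶ M' => γ x) h)
  choose β hβ using h1
  have inj : ∀ {x y : M}, f • x = f • y → x = y := fun {x y} hxy =>
    sub_eq_zero.1 (hp.reg _ (by rw [smul_sub, hxy, sub_self]))
  refine ⟨ModuleCat.ofHom
    { toFun := β, map_add' := fun x y => inj ?_, map_smul' := fun c x => inj ?_ }, ?_⟩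
  · rw [smul_add, ← hβ, ← hβ, ← hβ, map_add]
  · rw [RingHom.id_apply, smul_comm, ← hβ, ← hβ, map_smul]
  · ext x
    exact hβ x

theorem IsRegQuot.lift {X : ModuleCat.{0} R} [Projective X] (α : X ⟶ M') : ∃ β : X ⟶ M, β ≫ p = α :=
    by
  have : Epi p := (ModuleCat.epi_iff_surjective p).2 hp.surj
  exact ⟨Projective.factorThru α p, Projective.factorThru_comp α p⟩

theorem IsRegQuot.isEffaced {i : ℕ} (H : Effaceable J i M') (e : ℕ) {n : ℕ}
    (P : ProjectiveResolution (ModuleCat.of R (R ⧸ J ^ n))) (φ : P.complex.X (i + 1) ⟶ M)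
    (ψ : P.complex.X i ⟶ M) (h : f ^ e • φ = P.complex.d (i + 1) i ≫ ψ) : IsEffaced J P φ := by
  induction e generalizing n with
  | zero => exact .of_coboundary ψ (by simpa using h)
  | succ e ih =>
    obtain ⟨m, hm, Q, g, j, χ', w, hχ⟩ := H n P (ψ ≫ p) (by
      rw [← Category.assoc, ← h, pow_succ', mul_smul, Linear.smul_comp, ← Linear.comp_smul,
        hp.smul_eq_zero, comp_zero])
    obtain ⟨χ, rfl⟩ := hp.lift χ'
    obtain ⟨ψ', hψ'⟩ := hp.divide (α := g.f i ≫ ψ - Q.complex.d i j ≫ χ) (by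
      rw [Preadditive.sub_comp, Category.assoc, Category.assoc, hχ, sub_self])
    refine .of_comp w (ih Q _ ψ' (hp.cancel ?_))
    rw [← Linear.comp_smul _ _ _ (Q.complex.d (i + 1) i), ← hψ', Preadditive.comp_sub,
        HomologicalComplex.d_comp_d_assoc,
      zero_comp, sub_zero, ← HomologicalComplex.Hom.comm_assoc, ← h, smul_smul, ← pow_succ',
          Linear.comp_smul]

end

theorem powSmul_homotopy {f : R} (hf : f ∈ J) {n : ℕ}
    (P : ProjectiveResolution (ModuleCat.of R (R ⧸ J ^ n))) :
    Nonempty (Homotopy (f ^ n • 𝟙 P.complex) 0) := by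
  refine ⟨ProjectiveResolution.liftHomotopyZero _ ?_⟩
  ext x
  change ((f ^ n • 𝟙 P.complex) ≫ P.π).f 0 x = 0
  obtain ⟨y, hy⟩ := Submodule.Quotient.mk_surjective (J ^ n) (P.π.f 0 x)
  rw [Linear.smul_comp, Category.id_comp]
  change f ^ n • (P.π.f 0 x : R ⧸ J ^ n) = 0
  rw [← hy]
  exact (Submodule.Quotient.mk_eq_zero (J ^ n)).2
    (Ideal.mul_mem_right _ _ (Ideal.pow_mem_pow hf n))

theorem IsRegQuot.effaceable_succ {M M' : ModuleCat.{0} R} {f : R} {p : M ⟶ M'}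
    (hp : IsRegQuot f p.hom) (hf : f ∈ J) {i : ℕ} (H : Effaceable J i M') :
    Effaceable J (i + 1) M := by
  intro n P φ hφ
  obtain ⟨h⟩ := powSmul_homotopy hf P
  refine hp.isEffaced H n P φ (h.hom i (i + 1) ≫ φ) ?_
  have := congrArg (· ≫ φ) (h.comm (i + 1))
  simp only [Homotopy.dNext_succ_chainComplex, Homotopy.prevD_chainComplex, Preadditive.add_comp,
      Category.assoc, hφ] at this
  simpa using this

theorem IsRegQuot.effaceable_zero {M M' : ModuleCat.{0} R} {f : R} {p : M ⟶ M'}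
    (hp : IsRegQuot f p.hom) (hf : f ∈ J) : Effaceable J 0 M := by
  intro n P φ hφ
  obtain ⟨h⟩ := powSmul_homotopy hf P
  have := congrArg (· ≫ φ) (h.comm 0)
  simp only [Homotopy.dNext_zero_chainComplex, Homotopy.prevD_chainComplex, Preadditive.add_comp,
      Category.assoc, hφ] at this
  have h0 : f ^ n • φ = 0 := by simpa using this
  have := hp.pow_cancel n h0
  exact .of_coboundary (j := 0) 0 (by simp [this])

theorem IsRegQuot.effaceable_quot {M M' : ModuleCat.{0} R} {f : R} {p : M ⟶ M'}
    (hp : IsRegQuot f p.hom) {d : ℕ} (H : Effaceable J d M) (H' : Effaceable J (d + 1) M) :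
    Effaceable J d M' := by
  intro n P φ' hφ'
  obtain ⟨φ, rfl⟩ := hp.lift φ'
  obtain ⟨ψ, hψ⟩ := hp.divide (α := P.complex.d (d + 1) d ≫ φ) (by rw [Category.assoc, hφ'])
  obtain ⟨m, hm, Q, g, j, χ', w, hχ'⟩ := H' n P ψ (hp.cancel (by
    rw [← Linear.comp_smul, ← hψ]; simp))
  obtain ⟨χ, hχ⟩ : ∃ χ, g.f (d + 1) ≫ ψ = Q.complex.d (d + 1) d ≫ χ := by
    by_cases hj : j = d
    · subst hj; exact ⟨χ', hχ'⟩
    · refine ⟨0, ?_⟩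
      rw [hχ', Q.complex.shape _ _ (by simp; omega)]; simp
  refine .of_comp w ?_
  obtain ⟨m', hm', Q', g', j', ω, w', hω⟩ := H m Q (g.f d ≫ φ - f • χ) (by
    rw [Preadditive.comp_sub, ← HomologicalComplex.Hom.comm_assoc, hψ, Linear.comp_smul,
        Linear.comp_smul, hχ, sub_self])
  refine ⟨m', hm', Q', g', j', ω ≫ p, w', ?_⟩
  have := congrArg (· ≫ p) hω
  simpa [Preadditive.sub_comp, Preadditive.comp_sub, ← Linear.comp_smul, hp.smul_eq_zero] using this

theorem not_effaceable_zero {M : ModuleCat.{0} R} {x : M} (hx : x ≠ 0) (hJ : ∀ a ∈ J, a • x = 0) :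
    ¬ Effaceable J 0 M := by
  intro H
  let P := projectiveResolution (ModuleCat.of R (R ⧸ J ^ 1))
  let u : ModuleCat.of R (R ⧸ J ^ 1) ⟶ M := ModuleCat.ofHom
    (Submodule.liftQ (J ^ 1) (LinearMap.toSpanSingleton R M x) (by
      intro a ha
      rw [pow_one] at ha
      exact hJ a ha))
  let v : P.complex.X 0 ⟶ ModuleCat.of R (R ⧸ J ^ 1) := P.π.f 0
  have hv : P.complex.d 1 0 ≫ v = 0 := P.complex_d_comp_π_f_zero
  obtain ⟨m, hm, Q, g, j, ψ, w, h⟩ := H 1 P (v ≫ u) (by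
    change P.complex.d 1 0 ≫ v ≫ u = 0
    rw [reassoc_of% hv, zero_comp])
  rw [Q.complex.shape _ _ (by simp), zero_comp] at h
  let v' : Q.complex.X 0 ⟶ ModuleCat.of R (R ⧸ J ^ m) := Q.π.f 0
  have : Epi v' := inferInstanceAs (Epi (Q.π.f 0))
  have w0 : g.f 0 ≫ v = v' ≫ powProj J hm := by
    have := congrArg (fun γ => HomologicalComplex.Hom.f γ 0) w
    simp only [HomologicalComplex.comp_f, ChainComplex.single₀_map_f_zero] at this
    exact this
  rw [reassoc_of% w0] at h
  have h1 : powProj J hm ≫ u = 0 := by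
    have : v' ≫ (powProj J hm ≫ u) = v' ≫ 0 := by rw [h, comp_zero]
    exact (cancel_epi _).1 this
  apply hx
  have h2 := congrArg (fun γ => γ (Submodule.Quotient.mk 1 : R ⧸ J ^ m)) h1
  change (1 : R) • x = 0 at h2
  simpa using h2

end

section
open CategoryTheory Limits Opposite
open scoped Pointwise
variable {R : Type} [CommRing R] (J : Ideal R)

/-- `HasDepth J d M` holds if some `M`-regular sequence of length `d` in `J` leaves a quotient
with a nonzero element killed by `J`. -/
def HasDepth : ℕ → ∀ (M : Type) [AddCommGroup M] [Module R M], Prop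
  | 0, M, _, _ => ∃ x : M, x ≠ 0 ∧ ∀ a ∈ J, a • x = 0
  | d + 1, M, _, _ => ∃ (M' : Type) (_ : AddCommGroup M') (_ : Module R M') (f : R)
      (p : M →ₗ[R] M'), f ∈ J ∧ IsRegQuot f p ∧ HasDepth d M'

/-- Finitely generated modules `M` with `J M ≠ M`. -/
structure IsGood (M : Type) [AddCommGroup M] [Module R M] : Prop where
  fin : Module.Finite R M
  ne_top : J • (⊤ : Submodule R M) ≠ ⊤

variable {J} {M N : Type} [AddCommGroup M] [Module R M] [AddCommGroup N] [Module R N]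

theorem HasDepth.congr {d : ℕ} (h : HasDepth J d M) (e : M ≃ₗ[R] N) : HasDepth J d N := by
  cases d with
  | zero =>
    obtain ⟨x, hx, h⟩ := h
    exact ⟨e x, by simpa using hx, fun a ha => by rw [← map_smul, h a ha, map_zero]⟩
  | succ d =>
    obtain ⟨M', i1, i2, f, p, hf, hp, h⟩ := h
    refine ⟨M', i1, i2, f, p ∘ₗ e.symm.toLinearMap, hf, ⟨fun x hx => ?_, ?_, fun x => ?_⟩, h⟩
    · have := hp.reg (e.symm x) (by rw [← map_smul, hx, map_zero])
      simpa using this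
    · exact hp.surj.comp e.symm.surjective
    · refine (hp.ker (e.symm x)).trans ⟨?_, ?_⟩
      · rintro ⟨y, hy⟩
        exact ⟨e y, by rw [← map_smul, ← hy, e.apply_symm_apply]⟩
      · rintro ⟨y, rfl⟩
        exact ⟨e.symm y, map_smul _ _ _⟩

theorem HasDepth.effaceable {d : ℕ} (h : HasDepth J d M) :
    (∀ i < d, Effaceable J i (ModuleCat.of R M)) ∧ ¬ Effaceable J d (ModuleCat.of R M) := by
  induction d generalizing M with
  | zero =>
    obtain ⟨x, hx, h⟩ := h
    exact ⟨fun i hi => absurd hi (Nat.not_lt_zero i), not_effaceable_zero (M := ModuleCat.of R M) hx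
        h⟩
  | succ d ih =>
    obtain ⟨M', _, _, f, p, hf, hp, h⟩ := h
    replace hp : IsRegQuot f (ModuleCat.ofHom p).hom := hp
    obtain ⟨h1, h2⟩ := ih h
    have h3 : ∀ i < d + 1, Effaceable J i (ModuleCat.of R M) := by
      intro i hi
      cases i with
      | zero => exact hp.effaceable_zero hf
      | succ i => exact hp.effaceable_succ hf (h1 i (by omega))
    exact ⟨h3, fun h4 => h2 (hp.effaceable_quot (h3 d (by omega)) h4)⟩

theorem HasDepth.isLeast {d : ℕ} (h : HasDepth J d M) :
    IsLeast {i : ℕ | Nontrivial ((localCohomology J i).obj (ModuleCat.of R M))} d := by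
  refine ⟨?_, fun i hi => ?_⟩
  · have := h.effaceable.2
    rw [← subsingleton_localCohomology_iff] at this
    exact not_subsingleton_iff_nontrivial.1 this
  · by_contra hd
    have := h.effaceable.1 i (not_le.1 hd)
    rw [← subsingleton_localCohomology_iff] at this
    exact not_subsingleton_iff_nontrivial.2 hi this

theorem HasDepth.unique {d e : ℕ} (h : HasDepth J d M) (h' : HasDepth J e M) : d = e :=
  h.isLeast.unique h'.isLeast

theorem exists_regular [IsNoetherianRing R] [Module.Finite R M]
    (h : ∀ x : M, (∀ a ∈ J, a • x = 0) → x = 0) : ∃ f ∈ J, ∀ x : M, f • x = 0 → x = 0 := by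
  by_contra! hcon
  have h1 : (J : Set R) ⊆ ⋃ P ∈ associatedPrimes R M, (P : Set R) := by
    rw [biUnion_associatedPrimes_eq_zero_divisors]
    intro f hf
    obtain ⟨x, hx, hx0⟩ := hcon f hf
    exact ⟨x, hx0, hx⟩
  obtain ⟨P, hP, hJP⟩ := (Ideal.subset_union_prime_finite (associatedPrimes.finite R M)
    (f := id) 0 0 fun _ h _ _ ↦ h.isPrime).1 h1
  obtain ⟨hprime, x, hx⟩ := (isAssociatedPrime_iff).1 hP
  have h2 : x = 0 := h x fun a ha => by
    have : a ∈ P := hJP ha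
    rw [hx] at this
    simpa [Submodule.mem_colon_singleton] using this
  apply hprime.ne_top
  rw [hx, h2, Ideal.eq_top_iff_one]
  simp [Submodule.mem_colon_singleton]

theorem isRegQuot_mk {f : R} (h : ∀ x : M, f • x = 0 → x = 0) :
    IsRegQuot f (Submodule.mkQ (f • (⊤ : Submodule R M))) := by
  refine ⟨h, Submodule.mkQ_surjective _, fun x => ?_⟩
  rw [Submodule.mkQ_apply, Submodule.Quotient.mk_eq_zero, Submodule.mem_smul_pointwise_iff_exists]
  simp [eq_comm]

theorem IsGood.of_surjective_ne (h : IsGood J M) (p : M →ₗ[R] N) (hs : Function.Surjective p)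
    (hk : LinearMap.ker p ≤ J • ⊤) : IsGood J N := by
  have := h.fin
  refine ⟨Module.Finite.of_surjective p hs, fun h1 => h.ne_top (eq_top_iff.2 fun x _ => ?_)⟩
  have h2 : p x ∈ Submodule.map p (J • ⊤) := by
    rw [Submodule.map_smul'', Submodule.map_top, LinearMap.range_eq_top.2 hs, h1]
    trivial
  obtain ⟨y, hy, hxy⟩ := h2
  have h3 : x - y ∈ J • (⊤ : Submodule R M) := hk (by rw [LinearMap.mem_ker, map_sub, hxy,
      sub_self])
  simpa using add_mem h3 hy

theorem IsGood.of_surjective (h : IsGood J N) [Module.Finite R M] (p : M →ₗ[R] N)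
    (hs : Function.Surjective p) : IsGood J M := by
  refine ⟨‹_›, fun h1 => h.ne_top ?_⟩
  have := congrArg (Submodule.map p) h1
  rwa [Submodule.map_smul'', Submodule.map_top, LinearMap.range_eq_top.2 hs] at this

theorem IsGood.quot (h : IsGood J M) {f : R} (hf : f ∈ J) {p : M →ₗ[R] N} (hp : IsRegQuot f p) :
    IsGood J N := by
  refine h.of_surjective_ne p hp.surj fun x hx => ?_
  obtain ⟨y, rfl⟩ := (hp.ker x).1 hx
  exact Submodule.smul_mem_smul hf trivial

theorem IsGood.exists_hasDepth [IsNoetherianRing R] (h : IsGood J M) : ∃ d, HasDepth J d M := by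
  suffices H : ∀ (I : Ideal R) (M : Type) [AddCommGroup M] [Module R M], Module.annihilator R M = I
      →
      IsGood J M → ∃ d, HasDepth J d M from H _ M rfl h
  intro I
  induction I using WellFoundedGT.induction with
  | ind I ih =>
  rintro M _ _ rfl h
  by_cases hs : HasDepth J 0 M
  · exact ⟨0, hs⟩
  have := h.fin
  obtain ⟨f, hf, hreg⟩ := exists_regular (J := J) (M := M) fun x hx => by
    by_contra h0
    exact hs ⟨x, h0, hx⟩
  have hp := isRegQuot_mk hreg
  obtain ⟨d, hd⟩ := ih (Module.annihilator R (M ⧸ f • (⊤ : Submodule R M))) (by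
    refine lt_of_le_of_ne (LinearMap.annihilator_le_of_surjective _ hp.surj) fun heq => ?_
    have h1 : f ∈ Module.annihilator R M := by
      rw [heq]; exact QuotSMulTop.mem_annihilator M f
    apply h.ne_top
    have : Subsingleton M := ⟨fun x y => sub_eq_zero.1
      (hreg _ (Module.mem_annihilator.1 h1 _))⟩
    exact Subsingleton.elim _ _) _ rfl (h.quot hf hp)
  exact ⟨d + 1, _, _, _, f, _, hf, hp, hd⟩

theorem HasDepth.quot [IsNoetherianRing R] {d : ℕ} (h : HasDepth J d M) (hg : IsGood J M) {f : R}
    (hf : f ∈ J) {p : M →ₗ[R] N} (hp : IsRegQuot f p) : ∃ e, d = e + 1 ∧ HasDepth J e N := by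
  obtain ⟨e, he⟩ := (hg.quot hf hp).exists_hasDepth
  exact ⟨e, h.unique ⟨N, _, _, f, p, hf, hp, he⟩, he⟩

theorem HasDepth.pi [IsNoetherianRing R] {ι : Type} [Finite ι] {d : ι → ℕ} {W : ι → Type}
    [∀ i, AddCommGroup (W i)] [∀ i, Module R (W i)] (h : ∀ i, HasDepth J (d i) (W i))
    (hg : ∀ i, IsGood J (W i)) {m : ℕ} (hm : ∀ i, m ≤ d i) {i₀ : ι} (hi₀ : d i₀ = m) :
    HasDepth J m (∀ i, W i) := by
  classical
  induction m generalizing W d with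
  | zero =>
    have := h i₀
    rw [hi₀] at this
    obtain ⟨x, hx, hJ⟩ := this
    exact ⟨Pi.single i₀ x, by simpa using hx, fun a ha => by
      rw [← Pi.single_smul, hJ a ha, Pi.single_zero]⟩
  | succ m ih =>
    have := fun i => (hg i).fin
    obtain ⟨f, hf, hreg⟩ := exists_regular (J := J) (M := ∀ i, W i) fun x hx => by
      ext i
      by_contra h0
      have := (h i).unique (e := 0) ⟨x i, h0, fun a ha => congrFun (hx a ha) i⟩
      have := hm i
      omega
    have hp : ∀ i, IsRegQuot f (Submodule.mkQ (f • (⊤ : Submodule R (W i)))) := fun i =>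
      isRegQuot_mk fun x hx => by
        have := hreg (Pi.single i x) (by rw [← Pi.single_smul, hx, Pi.single_zero])
        simpa using this
    choose e he hd using fun i => (h i).quot (hg i) hf (hp i)
    refine ⟨∀ i, W i ⧸ f • (⊤ : Submodule R (W i)), inferInstance, inferInstance, f,
      LinearMap.pi fun i => Submodule.mkQ _ ∘ₗ LinearMap.proj i, hf,
          ⟨hreg, fun y => ?_, fun x => ?_⟩,
      ih hd (fun i => (hg i).quot hf (hp i)) (fun i => ?_) ?_⟩
    · choose x hx using fun i => (hp i).surj (y i)
      exact ⟨x, funext hx⟩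
    · rw [funext_iff]
      refine (forall_congr' fun i => (hp i).ker (x i)).trans ⟨fun H => ?_, fun ⟨y, hy⟩ i => ?_⟩
      · choose y hy using H
        exact ⟨y, funext hy⟩
      · exact ⟨y i, congrFun hy i⟩
    · have := hm i; have := he i; omega
    · have := he i₀; omega

end

section
open scoped TensorProduct
open scoped Pointwise

theorem tmul_ne_zero_of_field {k M N : Type} [Field k] [AddCommGroup M] [Module k M]
    [AddCommGroup N]
    [Module k N] {x : M} {y : N} (hx : x ≠ 0) (hy : y ≠ 0) : x ⊗ₜ[k] y ≠ 0 := by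
  intro h
  rw [Ne, ← Module.forall_dual_apply_eq_zero_iff k] at hx hy
  push Not at hx hy
  obtain ⟨φ, hφ⟩ := hx
  obtain ⟨ψ, hψ⟩ := hy
  have := congrArg (fun t => TensorProduct.lid k k (TensorProduct.map φ ψ t)) h
  simp [hφ, hψ] at this

variable {k A B R : Type} [Field k] [CommRing A] [Algebra k A] [CommRing B] [Algebra k B]
  [CommRing R] [Algebra k R]

/-- The `R`-module `T` is the external tensor product of `M` and `N`. -/
structure IsExtTensor (α : A →ₐ[k] R) (β : B →ₐ[k] R) {M N T : Type}
    [AddCommGroup M] [Module k M] [Module A M] [AddCommGroup N] [Module k N] [Module B N]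
    [AddCommGroup T] [Module k T] [Module R T] (e : M ⊗[k] N ≃ₗ[k] T) : Prop where
  left : ∀ a x y, α a • e (x ⊗ₜ y) = e ((a • x) ⊗ₜ y)
  right : ∀ b x y, β b • e (x ⊗ₜ y) = e (x ⊗ₜ (b • y))

variable {α : A →ₐ[k] R} {β : B →ₐ[k] R} {M N T : Type}
    [AddCommGroup M] [Module k M] [Module A M] [IsScalarTower k A M]
    [AddCommGroup N] [Module k N] [Module B N]
    [AddCommGroup T] [Module k T] [Module R T] [IsScalarTower k R T]

omit [IsScalarTower k A M] [IsScalarTower k R T] in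
theorem IsExtTensor.comm {e : M ⊗[k] N ≃ₗ[k] T} (h : IsExtTensor α β e) :
    IsExtTensor β α ((TensorProduct.comm k N M).trans e) :=
  ⟨fun b y x => by simpa using h.right b x y, fun a y x => by simpa using h.left a x y⟩

omit [IsScalarTower k R T] in
theorem IsExtTensor.smul_left {e : M ⊗[k] N ≃ₗ[k] T} (h : IsExtTensor α β e) (a : A) (t : M ⊗[k] N)
    :
    α a • e t = e (LinearMap.rTensor N ((LinearMap.lsmul A M a).restrictScalars k) t) := by
  induction t with
  | zero => simp
  | tmul x y => simpa using h.left a x y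
  | add t u ht hu => rw [map_add, smul_add, ht, hu, map_add, map_add]

theorem IsExtTensor.quot {M' : Type} [AddCommGroup M'] [Module k M'] [Module A M']
    [IsScalarTower k A M'] {e : M ⊗[k] N ≃ₗ[k] T} (h : IsExtTensor α β e)
    {f : A} {p : M →ₗ[A] M'} (hp : IsRegQuot f p) :
    ∃ (T' : Type) (_ : AddCommGroup T') (_ : Module k T') (_ : Module R T')
      (_ : IsScalarTower k R T') (q : T →ₗ[R] T') (e' : M' ⊗[k] N ≃ₗ[k] T'),
      IsRegQuot (α f) q ∧ IsExtTensor α β e' := by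
  let lf : M →ₗ[k] M := (LinearMap.lsmul A M f).restrictScalars k
  let pk : M →ₗ[k] M' := p.restrictScalars k
  let P : Submodule R T := α f • ⊤
  have hex : Function.Exact (lf.rTensor N) (pk.rTensor N) :=
    rTensor_exact N (fun x => (hp.ker x).trans ⟨fun ⟨y, hy⟩ => ⟨y, hy.symm⟩, fun ⟨y, hy⟩ =>
        ⟨y, hy.symm⟩⟩)
      hp.surj
  let q : T →ₗ[k] M' ⊗[k] N := pk.rTensor N ∘ₗ e.symm.toLinearMap
  have hq : Function.Surjective q :=
    (LinearMap.rTensor_surjective N (g := pk) hp.surj).comp e.symm.surjective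
  have hk : P.restrictScalars k = LinearMap.ker q := by
    ext t
    refine Iff.trans ?_ (hex (e.symm t)).symm
    rw [Submodule.restrictScalars_mem, Submodule.mem_smul_pointwise_iff_exists]
    constructor
    · rintro ⟨u, -, rfl⟩
      exact ⟨e.symm u, by rw [LinearEquiv.eq_symm_apply, ← h.smul_left, e.apply_symm_apply]⟩
    · rintro ⟨u, hu⟩
      exact ⟨e u, trivial, by rw [h.smul_left, hu, e.apply_symm_apply]⟩
  let e' : (T ⧸ P) ≃ₗ[k] M' ⊗[k] N := (Submodule.Quotient.restrictScalarsEquiv k P).symm.trans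
    ((Submodule.quotEquivOfEq _ _ hk).trans (q.quotKerEquivOfSurjective hq))
  have he' : ∀ t, e'.symm (pk.rTensor N t) = P.mkQ (e t) := by
    intro t
    rw [LinearEquiv.symm_apply_eq]
    change _ = q (e t)
    simp [q]
  have hreg : ∀ t : T, α f • t = 0 → t = 0 := by
    intro t ht
    obtain ⟨u, rfl⟩ := e.surjective t
    rw [h.smul_left, LinearEquiv.map_eq_zero_iff] at ht
    have : Function.Injective (lf.rTensor N) :=
      Module.Flat.rTensor_preserves_injective_linearMap lf
        ((injective_iff_map_eq_zero lf).2 hp.reg)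
    rw [(injective_iff_map_eq_zero _).1 this u ht, map_zero]
  refine ⟨T ⧸ P, inferInstance, inferInstance, inferInstance, inferInstance, P.mkQ, e'.symm,
    isRegQuot_mk hreg, fun a x y => ?_, fun b x y => ?_⟩
  · obtain ⟨x, rfl⟩ := hp.surj x
    have h1 := he' (x ⊗ₜ y)
    have h2 := he' ((a • x) ⊗ₜ y)
    rw [LinearMap.rTensor_tmul] at h1 h2
    change e'.symm (p x ⊗ₜ y) = _ at h1
    change e'.symm (p (a • x) ⊗ₜ y) = _ at h2
    rw [h1, ← map_smul P.mkQ, h.left, ← map_smul, h2]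
  · obtain ⟨x, rfl⟩ := hp.surj x
    have h1 := he' (x ⊗ₜ y)
    have h2 := he' (x ⊗ₜ (b • y))
    rw [LinearMap.rTensor_tmul] at h1 h2
    change e'.symm (p x ⊗ₜ y) = _ at h1
    change e'.symm (p x ⊗ₜ (b • y)) = _ at h2
    rw [h1, ← map_smul P.mkQ, h.right, h2]

theorem IsExtTensor.hasDepth [IsScalarTower k B N] {e : M ⊗[k] N ≃ₗ[k] T} (h : IsExtTensor α β e)
    {I : Ideal A} {J : Ideal B} {K : Ideal R} (hI : ∀ a ∈ I, α a ∈ K) (hJ : ∀ b ∈ J, β b ∈ K)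
    (hK : K ≤ I.map α ⊔ J.map β) {a b : ℕ} (ha : HasDepth I a M) (hb : HasDepth J b N) :
    HasDepth K (a + b) T := by
  induction a generalizing M T with
  | zero =>
    induction b generalizing N T with
    | zero =>
      obtain ⟨x, hx, hx'⟩ := ha
      obtain ⟨y, hy, hy'⟩ := hb
      refine ⟨e (x ⊗ₜ y), by simpa using tmul_ne_zero_of_field hx hy, fun r hr => ?_⟩
      have : I.map α ⊔ J.map β ≤ LinearMap.ker (LinearMap.toSpanSingleton R T (e (x ⊗ₜ y))) := by
        refine sup_le (Ideal.map_le_iff_le_comap.2 fun a ha => ?_)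
          (Ideal.map_le_iff_le_comap.2 fun b hb => ?_)
        · change α a • e (x ⊗ₜ y) = 0
          rw [h.left, hx' a ha, TensorProduct.zero_tmul, map_zero]
        · change β b • e (x ⊗ₜ y) = 0
          rw [h.right, hy' b hb, TensorProduct.tmul_zero, map_zero]
      exact this (hK hr)
    | succ b ih =>
      obtain ⟨N', _, _, f, p, hf, hp, hb⟩ := hb
      let _ : Module k N' := Module.compHom N' (algebraMap k B)
      have : IsScalarTower k B N' := IsScalarTower.of_algebraMap_smul fun _ _ => rfl
      obtain ⟨T', _, _, _, _, q, e', hq, he'⟩ := h.comm.quot hp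
      exact ⟨T', _, _, β f, q, hJ f hf, hq, ih hb he'.comm⟩
  | succ a ih =>
    obtain ⟨M', _, _, f, p, hf, hp, ha⟩ := ha
    let _ : Module k M' := Module.compHom M' (algebraMap k A)
    have : IsScalarTower k A M' := IsScalarTower.of_algebraMap_smul fun _ _ => rfl
    obtain ⟨T', _, _, _, _, q, e', hq, he'⟩ := h.quot hp
    rw [Nat.add_right_comm]
    exact ⟨T', _, _, α f, q, hI f hf, hq, ih he' ha⟩

end

section
open scoped TensorProduct
variable {k A B R : Type} [Field k] [CommRing A] [Algebra k A] [CommRing B] [Algebra k B]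
  [CommRing R] [Algebra k R]

/-- `R` is the tensor product of `A` and `B` over `k`, via `α` and `β`. -/
structure IsTensorAlg (α : A →ₐ[k] R) (β : B →ₐ[k] R) (μ : A ⊗[k] B ≃ₐ[k] R) : Prop where
  tmul : ∀ a b, μ (a ⊗ₜ b) = α a * β b

variable {α : A →ₐ[k] R} {β : B →ₐ[k] R} {μ : A ⊗[k] B ≃ₐ[k] R}

variable (α β) in
/-- The `k`-span of the products of elements of `I` and `J`. -/
def prodSpan (I : Ideal A) (J : Ideal B) : Submodule k R :=
  Submodule.span k {x | ∃ a ∈ I, ∃ b ∈ J, α a * β b = x}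

namespace IsTensorAlg

theorem prodSpan_top (h : IsTensorAlg α β μ) : prodSpan α β ⊤ ⊤ = ⊤ := by
  refine eq_top_iff.2 fun x _ => ?_
  obtain ⟨t, rfl⟩ := μ.surjective x
  induction t with
  | zero => rw [map_zero]; exact zero_mem _
  | tmul a b => rw [h.tmul]; exact Submodule.subset_span ⟨a, trivial, b, trivial, rfl⟩
  | add t u ht hu => rw [map_add]; exact add_mem (ht trivial) (hu trivial)

theorem mul_mem_prodSpan (h : IsTensorAlg α β μ) {I : Ideal A} {J : Ideal B} (r : R) {x : R}
    (hx : x ∈ prodSpan α β I J) : r * x ∈ prodSpan α β I J := by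
  have h1 : prodSpan α β ⊤ ⊤ * prodSpan α β I J ≤ prodSpan α β I J := by
    rw [prodSpan, prodSpan, Submodule.span_mul_span]
    refine Submodule.span_mono ?_
    rintro _ ⟨_, ⟨a, -, b, -, rfl⟩, _, ⟨a', ha', b', hb', rfl⟩, rfl⟩
    exact ⟨a * a', I.mul_mem_left _ ha', b * b', J.mul_mem_left _ hb', by
      simp only [map_mul]; ring⟩
  exact h1 (Submodule.mul_mem_mul (by rw [h.prodSpan_top]; trivial) hx)

theorem mem_map_mul_map_iff (h : IsTensorAlg α β μ) {I : Ideal A} {J : Ideal B} {x : R} :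
    x ∈ I.map α * J.map β ↔ x ∈ prodSpan α β I J := by
  constructor
  · intro hx
    rw [Ideal.map, Ideal.map, Ideal.span_mul_span'] at hx
    refine Submodule.span_induction ?_ (zero_mem _) (fun _ _ _ _ => add_mem)
      (fun r x _ hx => h.mul_mem_prodSpan r hx) hx
    rintro _ ⟨_, ⟨a, ha, rfl⟩, _, ⟨b, hb, rfl⟩, rfl⟩
    exact Submodule.subset_span ⟨a, ha, b, hb, rfl⟩
  · intro hx
    have : prodSpan α β I J ≤ (I.map α * J.map β).restrictScalars k := by
      refine Submodule.span_le.2 ?_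
      rintro _ ⟨a, ha, b, hb, rfl⟩
      exact Ideal.mul_mem_mul (Ideal.mem_map_of_mem α ha) (Ideal.mem_map_of_mem β hb)
    exact this hx

theorem inf_eq_mul (h : IsTensorAlg α β μ) (I : Ideal A) (J : Ideal B) :
    I.map α ⊓ J.map β = I.map α * J.map β := by
  refine le_antisymm ?_ Ideal.mul_le_inf
  rintro x ⟨hxI, hxJ⟩
  obtain ⟨p, hp⟩ := LinearMap.exists_leftInverse_of_injective
    (I.restrictScalars k).subtype (Submodule.ker_subtype _)
  obtain ⟨q, hq⟩ := LinearMap.exists_leftInverse_of_injective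
    (J.restrictScalars k).subtype (Submodule.ker_subtype _)
  let p' : A →ₗ[k] A := (I.restrictScalars k).subtype ∘ₗ p
  let q' : B →ₗ[k] B := (J.restrictScalars k).subtype ∘ₗ q
  have hp' : ∀ a ∈ I, p' a = a := fun a ha =>
    congrArg Subtype.val (LinearMap.congr_fun hp ⟨a, ha⟩)
  have hq' : ∀ b ∈ J, q' b = b := fun b hb =>
    congrArg Subtype.val (LinearMap.congr_fun hq ⟨b, hb⟩)
  have hμ : ∀ a b, μ.symm (α a * β b) = a ⊗ₜ b := fun a b => by
    rw [← h.tmul, AlgEquiv.symm_apply_apply]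
  have h1 : p'.rTensor B (μ.symm x) = μ.symm x := by
    have hx : x ∈ prodSpan α β I ⊤ := by
      rw [← h.mem_map_mul_map_iff, Ideal.map_top, Ideal.mul_top]; exact hxI
    refine Submodule.span_induction (p := fun x _ => p'.rTensor B (μ.symm x) = μ.symm x)
      ?_ (by simp) (fun x y _ _ hx hy => by simp only [map_add, hx, hy])
      (fun c x _ hx => by simp only [map_smul, hx]) hx
    rintro _ ⟨a, ha, b, -, rfl⟩
    rw [hμ, LinearMap.rTensor_tmul, hp' a ha]
  have h2 : q'.lTensor A (μ.symm x) = μ.symm x := by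
    have hx : x ∈ prodSpan α β ⊤ J := by
      rw [← h.mem_map_mul_map_iff, Ideal.map_top, Ideal.top_mul]; exact hxJ
    refine Submodule.span_induction (p := fun x _ => q'.lTensor A (μ.symm x) = μ.symm x)
      ?_ (by simp) (fun x y _ _ hx hy => by simp only [map_add, hx, hy])
      (fun c x _ hx => by simp only [map_smul, hx]) hx
    rintro _ ⟨a, -, b, hb, rfl⟩
    rw [hμ, LinearMap.lTensor_tmul, hq' b hb]
  have h3 : ∀ t, μ (p'.rTensor B (q'.lTensor A t)) ∈ prodSpan α β I J := by
    intro t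
    induction t with
    | zero => simp
    | tmul a b =>
      rw [LinearMap.lTensor_tmul, LinearMap.rTensor_tmul, h.tmul]
      exact Submodule.subset_span ⟨_, (p a).2, _, (q b).2, rfl⟩
    | add t u ht hu => simp only [map_add]; exact add_mem ht hu
  have := h3 (μ.symm x)
  rw [h2, h1, AlgEquiv.apply_symm_apply] at this
  exact h.mem_map_mul_map_iff.2 this

theorem inf_sup_le (h : IsTensorAlg α β μ) {I I' : Ideal A} {J J' : Ideal B} (hI : I' ≤ I)
    (hJ : J' ≤ J) : (I.map α * J.map β) ⊓ (I'.map α ⊔ J'.map β) ≤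
      I'.map α * J.map β ⊔ I.map α * J'.map β := by
  rintro x ⟨hx, hx'⟩
  rw [← h.inf_eq_mul] at hx
  obtain ⟨u, hu, v, hv, rfl⟩ := Submodule.mem_sup.1 hx'
  have huI := Ideal.map_mono (f := α) hI hu
  have hvJ := Ideal.map_mono (f := β) hJ hv
  refine Submodule.add_mem_sup ?_ ?_
  · rw [← h.inf_eq_mul]
    exact ⟨hu, by simpa using sub_mem hx.2 hvJ⟩
  · rw [← h.inf_eq_mul]
    exact ⟨by simpa using sub_mem hx.1 huI, hv⟩

/-- The image of `I * J` modulo `I' + J'`. -/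
abbrev grProd (α : A →ₐ[k] R) (β : B →ₐ[k] R) (I I' : Ideal A) (J J' : Ideal B) :
    Submodule R (R ⧸ (I'.map α ⊔ J'.map β)) :=
  Submodule.map (I'.map α ⊔ J'.map β).mkQ (I.map α * J.map β)

theorem exists_isExtTensor (h : IsTensorAlg α β μ) (I I' : Ideal A) (J J' : Ideal B) :
    ∃ e : (↥I ⧸ Submodule.comap I.subtype I') ⊗[k] (↥J ⧸ Submodule.comap J.subtype J') ≃ₗ[k]
      grProd α β I I' J J', IsExtTensor α β e := by
  let L := I'.map α ⊔ J'.map β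
  let αbar : (A ⧸ I') →ₐ[k] R ⧸ L := Ideal.quotientMapₐ L α
    (Ideal.map_le_iff_le_comap.1 le_sup_left)
  let βbar : (B ⧸ J') →ₐ[k] R ⧸ L := Ideal.quotientMapₐ L β
    (Ideal.map_le_iff_le_comap.1 le_sup_right)
  let m : (A ⧸ I') ⊗[k] (B ⧸ J') →ₐ[k] R ⧸ L := Algebra.TensorProduct.productMap αbar βbar
  let θ : R →ₐ[k] (A ⧸ I') ⊗[k] (B ⧸ J') :=
    (Algebra.TensorProduct.map (Ideal.Quotient.mkₐ k I') (Ideal.Quotient.mkₐ k J')).comp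
      μ.symm.toAlgHom
  have hθ : ∀ a b, θ (α a * β b) = (Ideal.Quotient.mk I' a) ⊗ₜ (Ideal.Quotient.mk J' b) := by
    intro a b
    rw [← h.tmul]
    simp [θ]
  have hθL : ∀ x ∈ L, θ x = 0 := by
    have : L ≤ RingHom.ker θ := by
      refine sup_le (Ideal.map_le_iff_le_comap.2 fun a ha => ?_)
        (Ideal.map_le_iff_le_comap.2 fun b hb => ?_)
      · have := hθ a 1
        rw [map_one, mul_one, Ideal.Quotient.eq_zero_iff_mem.2 ha, TensorProduct.zero_tmul] at this
        exact this
      · have := hθ 1 b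
        rw [map_one, one_mul, Ideal.Quotient.eq_zero_iff_mem.2 hb, TensorProduct.tmul_zero] at this
        exact this
    exact this
  let θbar : R ⧸ L →ₐ[k] (A ⧸ I') ⊗[k] (B ⧸ J') := Ideal.Quotient.liftₐ L θ hθL
  have hθm : ∀ t, θbar (m t) = t := by
    intro t
    induction t with
    | zero => simp
    | tmul a b =>
      obtain ⟨a, rfl⟩ := Ideal.Quotient.mk_surjective a
      obtain ⟨b, rfl⟩ := Ideal.Quotient.mk_surjective b
      exact hθ a b
    | add t u ht hu => rw [map_add, map_add, ht, hu]
  let ιA : (↥I ⧸ Submodule.comap I.subtype I') →ₗ[A] A ⧸ I' := Submodule.mapQ _ _ I.subtype le_rfl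
  let ιB : (↥J ⧸ Submodule.comap J.subtype J') →ₗ[B] B ⧸ J' := Submodule.mapQ _ _ J.subtype le_rfl
  have hιA : Function.Injective ιA := by
    rw [injective_iff_map_eq_zero]
    intro x hx
    obtain ⟨x, rfl⟩ := Submodule.Quotient.mk_surjective _ x
    exact (Submodule.Quotient.mk_eq_zero _).2 ((Submodule.Quotient.mk_eq_zero I').1 hx)
  have hιB : Function.Injective ιB := by
    rw [injective_iff_map_eq_zero]
    intro x hx
    obtain ⟨x, rfl⟩ := Submodule.Quotient.mk_surjective _ x
    exact (Submodule.Quotient.mk_eq_zero _).2 ((Submodule.Quotient.mk_eq_zero J').1 hx)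
  let j := m.toLinearMap ∘ₗ TensorProduct.map (ιA.restrictScalars k) (ιB.restrictScalars k)
  have hj : Function.Injective j := by
    have hm : Function.Injective m := Function.LeftInverse.injective hθm
    exact hm.comp (TensorProduct.map_injective_of_flat_flat _ _ hιA hιB)
  have hjt : ∀ (a : I) (b : J), j (Submodule.Quotient.mk a ⊗ₜ Submodule.Quotient.mk b) =
    L.mkQ (α a * β b) := fun a b => rfl
  have hr : LinearMap.range j = (grProd α β I I' J J').restrictScalars k := by
    apply le_antisymm
    · rintro _ ⟨t, rfl⟩
      induction t with
      | zero => simp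
      | tmul x y =>
        obtain ⟨a, rfl⟩ := Submodule.Quotient.mk_surjective _ x
        obtain ⟨b, rfl⟩ := Submodule.Quotient.mk_surjective _ y
        rw [hjt]
        exact ⟨_, Ideal.mul_mem_mul (Ideal.mem_map_of_mem α a.2) (Ideal.mem_map_of_mem β b.2), rfl⟩
      | add t u ht hu => rw [map_add]; exact add_mem ht hu
    · rintro _ ⟨x, hx, rfl⟩
      have hx' := h.mem_map_mul_map_iff.1 hx
      have : prodSpan α β I J ≤ (LinearMap.range j).comap (L.mkQ.restrictScalars k) := by
        refine Submodule.span_le.2 ?_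
        rintro _ ⟨a, ha, b, hb, rfl⟩
        exact ⟨_, hjt ⟨a, ha⟩ ⟨b, hb⟩⟩
      exact this hx'
  let e : _ ≃ₗ[k] grProd α β I I' J J' := (LinearEquiv.ofInjective j hj).trans
      (LinearEquiv.ofEq _ _ hr)
  refine ⟨e, fun a x y => ?_, fun b x y => ?_⟩
  · obtain ⟨x, rfl⟩ := Submodule.Quotient.mk_surjective _ x
    obtain ⟨y, rfl⟩ := Submodule.Quotient.mk_surjective _ y
    apply Subtype.ext
    change α a • j (_ ⊗ₜ _) = j ((a • _) ⊗ₜ _)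
    rw [← Submodule.Quotient.mk_smul, hjt, hjt, ← map_smul]
    simp [mul_assoc]
  · obtain ⟨x, rfl⟩ := Submodule.Quotient.mk_surjective _ x
    obtain ⟨y, rfl⟩ := Submodule.Quotient.mk_surjective _ y
    apply Subtype.ext
    change β b • j (_ ⊗ₜ _) = j (_ ⊗ₜ (b • _))
    rw [← Submodule.Quotient.mk_smul, hjt, hjt, ← map_smul]
    simp [mul_left_comm]

end IsTensorAlg
end

section
open scoped TensorProduct
variable {k A B R : Type} [Field k] [CommRing A] [Algebra k A] [CommRing B] [Algebra k B]
  [CommRing R] [Algebra k R] {α : A →ₐ[k] R} {β : B →ₐ[k] R} {M N T : Type}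
  [AddCommGroup M] [Module k M] [Module A M] [IsScalarTower k A M]
  [AddCommGroup N] [Module k N] [Module B N] [IsScalarTower k B N]
  [AddCommGroup T] [Module k T] [Module R T]

theorem IsExtTensor.isGood {e : M ⊗[k] N ≃ₗ[k] T} (h : IsExtTensor α β e)
    {I : Ideal A} {J : Ideal B} {K : Ideal R} (hK : K ≤ I.map α ⊔ J.map β)
    (hM : IsGood I M) (hN : IsGood J N) [hT : Module.Finite R T] : IsGood K T := by
  refine ⟨hT, fun htop => ?_⟩
  let pM : M →ₗ[k] M ⧸ (I • ⊤ : Submodule A M) := (Submodule.mkQ _).restrictScalars k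
  let pN : N →ₗ[k] N ⧸ (J • ⊤ : Submodule B N) := (Submodule.mkQ _).restrictScalars k
  let π := TensorProduct.map pM pN
  have h0 : ∀ t : T, π (e.symm t) = 0 := by
    let Z : Ideal R :=
      { carrier := {r | ∀ t : T, π (e.symm (r • t)) = 0}
        zero_mem' := fun t => by simp
        add_mem' := fun {a b} ha hb t => by rw [add_smul, map_add, map_add, ha t, hb t, add_zero]
        smul_mem' := fun c r hr t => by rw [smul_eq_mul, mul_comm, mul_smul, hr] }
    have hZ : K ≤ Z := by
      refine hK.trans (sup_le (Ideal.map_le_iff_le_comap.2 fun a ha => ?_)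
          (Ideal.map_le_iff_le_comap.2 fun b hb => ?_))
      · intro t
        obtain ⟨t, rfl⟩ := e.surjective t
        induction t with
        | zero => simp
        | tmul x y =>
          rw [h.left, e.symm_apply_apply, TensorProduct.map_tmul]
          have : pM (a • x) = 0 :=
            (Submodule.Quotient.mk_eq_zero _).2 (Submodule.smul_mem_smul ha trivial)
          rw [this, TensorProduct.zero_tmul]
        | add t u ht hu => rw [map_add, smul_add, map_add, map_add, ht, hu, add_zero]
      · intro t
        obtain ⟨t, rfl⟩ := e.surjective t
        induction t with
        | zero => simp
        | tmul x y =>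
          rw [h.right, e.symm_apply_apply, TensorProduct.map_tmul]
          have : pN (b • y) = 0 :=
            (Submodule.Quotient.mk_eq_zero _).2 (Submodule.smul_mem_smul hb trivial)
          rw [this, TensorProduct.tmul_zero]
        | add t u ht hu => rw [map_add, smul_add, map_add, map_add, ht, hu, add_zero]
    intro t
    have ht : t ∈ K • (⊤ : Submodule R T) := by rw [htop]; trivial
    induction ht using Submodule.smul_induction_on' with
    | smul r hr t _ => exact hZ hr t
    | add x _ y _ hx hy => rw [map_add, map_add, hx, hy, add_zero]
  have hM' : ∃ x, pM x ≠ 0 := by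
    by_contra! hc
    exact hM.ne_top (eq_top_iff.2 fun x _ => (Submodule.Quotient.mk_eq_zero _).1 (hc x))
  have hN' : ∃ x, pN x ≠ 0 := by
    by_contra! hc
    exact hN.ne_top (eq_top_iff.2 fun x _ => (Submodule.Quotient.mk_eq_zero _).1 (hc x))
  obtain ⟨x, hx⟩ := hM'
  obtain ⟨y, hy⟩ := hN'
  have := h0 (e (x ⊗ₜ y))
  rw [e.symm_apply_apply, TensorProduct.map_tmul] at this
  exact tmul_ne_zero_of_field hx hy this

end

section
variable {R : Type} [CommRing R]

theorem Ideal.mem_finsetSum_iff {ι : Type} [Fintype ι] {W : ι → Ideal R} {x : R} :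
    x ∈ ∑ i, W i ↔ ∃ q : ι → R, (∀ i, q i ∈ W i) ∧ ∑ i, q i = x := by
  have h : ∑ i, W i = ⨆ i ∈ Finset.univ, W i := by
    rw [← Finset.sup_eq_iSup]; rfl
  rw [h, Submodule.mem_iSup_finset_iff_exists_sum]
  exact ⟨fun ⟨q, hq⟩ => ⟨fun i => q i, fun i => (q i).2, hq⟩,
    fun ⟨q, hq, hx⟩ => ⟨fun i => ⟨q i, hq i⟩, hx⟩⟩

theorem Ideal.sup_pow_eq_sum (X Y : Ideal R) (n : ℕ) :
    (X ⊔ Y) ^ n = ∑ i : Fin (n + 1), X ^ (i : ℕ) * Y ^ (n - i : ℕ) := by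
  rw [← Submodule.add_eq_sup, add_pow, Finset.sum_range]
  refine Finset.sum_congr rfl fun i _ => ?_
  have hc : n.choose i ≠ 0 := (Nat.choose_pos (Nat.lt_succ_iff.1 i.2)).ne'
  rw [← Nat.succ_pred_eq_of_ne_zero hc]
  generalize (n.choose i).pred = m
  have : ((m.succ : ℕ) : Ideal R) = 1 := by
    induction m with
    | zero => simp
    | succ m ih => rw [Nat.cast_succ, ih, add_idem]
  rw [this, mul_one]

variable (X Y : ℕ → Ideal R)

/-- The `n`-th term of the product of two filtrations. -/
def mulFiltration (n : ℕ) : Ideal R := ∑ i : Fin (n + 1), X i * Y (n - i)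

/-- The modulus of the `(i, j)`-th piece of the product of two filtrations. -/
abbrev grModulus (i j : ℕ) : Ideal R := X (i + 1) ⊔ Y (j + 1)

/-- The `(i, j)`-th piece of the product of two filtrations. -/
abbrev grPiece (i j : ℕ) : Submodule R (R ⧸ grModulus X Y i j) :=
  Submodule.map (grModulus X Y i j).mkQ (X i * Y j)

variable {X Y} (hX : Antitone X) (hY : Antitone Y)

theorem mul_le_mulFiltration {a b n : ℕ} (h : a + b = n) : X a * Y b ≤ mulFiltration X Y n := by
  intro x hx
  subst h
  refine Ideal.mem_finsetSum_iff.2 ⟨Pi.single (Fin.mk a (by omega)) x, fun i => ?_, by simp⟩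
  by_cases hi : i = Fin.mk a (by omega)
  · subst hi
    simpa using hx
  · rw [Pi.single_eq_of_ne hi]; exact zero_mem _

include hX hY in
theorem mul_le_grModulus {a b i j : ℕ} (h : i < a ∨ j < b) : X a * Y b ≤ grModulus X Y i j := by
  rcases h with h | h
  · exact Ideal.mul_le_left.trans ((hX h).trans le_sup_left)
  · exact Ideal.mul_le_right.trans ((hY h).trans le_sup_right)

include hX hY in
theorem mulFiltration_succ_le {i j n : ℕ} (h : i + j = n) :
    mulFiltration X Y (n + 1) ≤ grModulus X Y i j := by
  intro x hx
  obtain ⟨q, hq, rfl⟩ := Ideal.mem_finsetSum_iff.1 hx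
  exact sum_mem fun a _ => mul_le_grModulus hX hY (by omega) (hq a)

include hX hY in
theorem sum_sub_mem_grModulus {n : ℕ} {q : Fin (n + 1) → R}
    (hq : ∀ a : Fin (n + 1), q a ∈ X a * Y (n - a)) (i : Fin (n + 1)) :
    ∑ a, q a - q i ∈ grModulus X Y i (n - i) := by
  rw [← Finset.sum_erase_eq_sub (Finset.mem_univ i)]
  refine sum_mem fun a ha => mul_le_grModulus hX hY ?_ (hq a)
  have : (a : ℕ) ≠ i := fun h => Finset.ne_of_mem_erase ha (Fin.ext h)
  omega

include hX hY in
theorem mkQ_mem_grPiece {n : ℕ} {x : R} (hx : x ∈ mulFiltration X Y n) (i : Fin (n + 1)) :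
    (grModulus X Y i (n - i)).mkQ x ∈ grPiece X Y i (n - i) := by
  obtain ⟨q, hq, rfl⟩ := Ideal.mem_finsetSum_iff.1 hx
  exact ⟨q i, hq i, ((Submodule.Quotient.eq _).2 (sum_sub_mem_grModulus hX hY hq i)).symm⟩

theorem nonempty_equiv_pi_grPiece
    (h : ∀ i j, X i * Y j ⊓ grModulus X Y i j ≤ X (i + 1) * Y j ⊔ X i * Y (j + 1))
    (hX : Antitone X) (hY : Antitone Y) (n : ℕ) :
    Nonempty ((↥(mulFiltration X Y n) ⧸
        Submodule.comap (mulFiltration X Y n).subtype (mulFiltration X Y (n + 1))) ≃ₗ[R]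
      ∀ i : Fin (n + 1), grPiece X Y i (n - i)) := by
  let φ : mulFiltration X Y n →ₗ[R] ∀ i : Fin (n + 1), grPiece X Y i (n - i) :=
    LinearMap.pi fun i => LinearMap.codRestrict _
      ((grModulus X Y i (n - i)).mkQ ∘ₗ Submodule.subtype _)
      fun x => mkQ_mem_grPiece hX hY x.2 i
  have hs : Function.Surjective φ := by
    intro g
    choose q hq hg using fun i => (g i).2
    refine ⟨⟨∑ i, q i, Ideal.mem_finsetSum_iff.2 ⟨q, hq, rfl⟩⟩, funext fun i => Subtype.ext ?_⟩
    rw [← hg]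
    exact (Submodule.Quotient.eq _).2 (sum_sub_mem_grModulus hX hY hq i)
  have hk : Submodule.comap (mulFiltration X Y n).subtype (mulFiltration X Y (n + 1)) =
      LinearMap.ker φ := by
    ext ⟨x, hx⟩
    rw [LinearMap.mem_ker, Submodule.mem_comap]
    constructor
    · intro hx'
      refine funext fun i => Subtype.ext ?_
      exact (Submodule.Quotient.mk_eq_zero _).2 (mulFiltration_succ_le hX hY (by omega) hx')
    · intro hx'
      have hx'' : ∀ i : Fin (n + 1), x ∈ grModulus X Y i (n - i) := fun i =>
        (Submodule.Quotient.mk_eq_zero _).1 (congrArg Subtype.val (congrFun hx' i))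
      obtain ⟨q, hq, rfl⟩ := Ideal.mem_finsetSum_iff.1 hx
      change ∑ i, q i ∈ mulFiltration X Y (n + 1)
      refine sum_mem fun i _ => ?_
      have hi : q i ∈ grModulus X Y i (n - i) := by
        rw [← sub_sub_cancel (∑ a, q a) (q i)]
        exact sub_mem (hx'' i) (sum_sub_mem_grModulus hX hY hq i)
      have hle : X (i + 1) * Y (n - i) ⊔ X i * Y (n - i + 1) ≤ mulFiltration X Y (n + 1) :=
        sup_le (mul_le_mulFiltration (by omega)) (mul_le_mulFiltration (by omega))
      exact hle (h _ _ ⟨hq i, hi⟩)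
  exact ⟨(Submodule.quotEquivOfEq _ _ hk).trans (φ.quotKerEquivOfSurjective hs)⟩
end

section
open scoped TensorProduct
variable {k A B R : Type} [Field k] [CommRing A] [Algebra k A] [CommRing B] [Algebra k B]
  [CommRing R] [Algebra k R] {α : A →ₐ[k] R} {β : B →ₐ[k] R}
  {μ : A ⊗[k] B ≃ₐ[k] R}

/-- The `n`-th graded component of the associated graded ring of `I`. -/
abbrev assocGr {P : Type} [CommRing P] (I : Ideal P) (n : ℕ) : Type :=
  ↥(I ^ n) ⧸ Submodule.comap (I ^ n).subtype (I ^ (n + 1))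

theorem Ideal.map_sup_map_pow (I : Ideal A) (J : Ideal B) (n : ℕ) :
    (I.map α ⊔ J.map β) ^ n =
      mulFiltration (fun i => (I ^ i).map α) (fun j => (J ^ j).map β) n := by
  simp only [Ideal.sup_pow_eq_sum, mulFiltration, Ideal.map_pow]

theorem IsTensorAlg.hasDepth_assocGr [IsNoetherianRing R] (h : IsTensorAlg α β μ) {I mA : Ideal A}
    {J mB : Ideal B}
    {mR : Ideal R} (hA : ∀ a ∈ mA, α a ∈ mR) (hB : ∀ b ∈ mB, β b ∈ mR)
    (hR : mR ≤ mA.map α ⊔ mB.map β) {a b : ℕ → ℕ}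
    (ha : ∀ i, HasDepth mA (a i) (assocGr I i)) (hga : ∀ i, IsGood mA (assocGr I i))
    (hb : ∀ i, HasDepth mB (b i) (assocGr J i)) (hgb : ∀ i, IsGood mB (assocGr J i))
    {n m : ℕ} (hm : ∀ i j, i + j = n → m ≤ a i + b j) (hm' : ∃ i j, i + j = n ∧ a i + b j = m) :
    HasDepth mR m (assocGr (I.map α ⊔ J.map β) n) := by
  have hX : Antitone fun i => (I ^ i).map α := fun i j hij => Ideal.map_mono
      (Ideal.pow_le_pow_right hij)
  have hY : Antitone fun j => (J ^ j).map β := fun i j hij => Ideal.map_mono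
      (Ideal.pow_le_pow_right hij)
  obtain ⟨e⟩ := nonempty_equiv_pi_grPiece (fun i j => h.inf_sup_le
    (Ideal.pow_le_pow_right i.le_succ) (Ideal.pow_le_pow_right j.le_succ)) hX hY n
  have hi : ∀ i : Fin (n + 1), HasDepth mR (a i + b (n - i))
      (IsTensorAlg.grProd α β (I ^ (i : ℕ)) (I ^ (i + 1 : ℕ)) (J ^ (n - i : ℕ))
          (J ^ (n - i + 1 : ℕ)))
      ∧ IsGood mR (IsTensorAlg.grProd α β (I ^ (i : ℕ)) (I ^ (i + 1 : ℕ)) (J ^ (n - i : ℕ))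
          (J ^ (n - i + 1 : ℕ))) := by
    intro i
    obtain ⟨e, he⟩ := h.exists_isExtTensor (I ^ (i : ℕ)) (I ^ (i + 1 : ℕ)) (J ^ (n - i : ℕ))
      (J ^ (n - i + 1 : ℕ))
    exact ⟨he.hasDepth hA hB hR (ha _) (hb _), he.isGood hR (hga _) (hgb _)⟩
  obtain ⟨i₀, j₀, rfl, h₀⟩ := hm'
  have key := (HasDepth.pi (fun i => (hi i).1) (fun i => (hi i).2)
    (fun i => hm i _ (by omega)) (i₀ := Fin.mk i₀ (by omega)) (by simpa using h₀)).congr e.symm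
  unfold assocGr
  rw [Ideal.map_sup_map_pow, Ideal.map_sup_map_pow]
  exact key

end

section
open scoped TensorProduct
open PaperHTT

theorem IsGood.of_ideal_ne_bot {P : Type} [CommRing P] [IsDomain P] [IsNoetherianRing P]
    {I m : Ideal P} (hI : I ≠ ⊥) (hm : m ≠ ⊤) (hIm : I ≤ m) (n : ℕ) :
    IsGood m (assocGr I n) := by
  refine ⟨inferInstance, fun htop => ?_⟩
  have hle : I ^ n ≤ m • I ^ n := by
    intro x hx
    have hx' : (Submodule.comap (I ^ n).subtype (I ^ (n + 1))).mkQ ⟨x, hx⟩ ∈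
        m • (⊤ : Submodule P (assocGr I n)) := by
      rw [htop]; trivial
    rw [← Submodule.range_mkQ, ← Submodule.map_top, ← Submodule.map_smul''] at hx'
    obtain ⟨y, hy, hyx⟩ := hx'
    have hy' : (y : P) ∈ m • I ^ n := by
      have := Submodule.mem_map_of_mem (f := (I ^ n).subtype) hy
      rwa [Submodule.map_smul'', Submodule.map_top, Submodule.range_subtype] at this
    have hd : (y : P) - x ∈ I ^ (n + 1) := by
      have := (Submodule.Quotient.eq _).1 hyx
      exact this
    rw [pow_succ'] at hd
    rw [← sub_sub_cancel (y : P) x]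
    exact sub_mem hy' (Ideal.mul_mono_left hIm hd)
  obtain ⟨r, hr, hr0⟩ := Submodule.exists_sub_one_mem_and_smul_eq_zero_of_fg_of_le_smul m (I ^ n)
    (IsNoetherian.noetherian _) hle
  obtain ⟨x, hx, hx0⟩ := Submodule.exists_mem_ne_zero_of_ne_bot
    (pow_ne_zero n hI : I ^ n ≠ ⊥)
  have hr' : r = 0 := (mul_eq_zero.1 (hr0 x hx)).resolve_right hx0
  rw [hr', zero_sub, neg_mem_iff] at hr
  exact hm ((Ideal.eq_top_iff_one m).2 hr)

variable {k : Type} [Field k] {σ τ : Type}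

theorem mem_maxHomIdeal_iff {f : MvPolynomial σ k} :
    f ∈ maxHomIdeal k σ ↔ MvPolynomial.coeff 0 f = 0 := by
  rw [maxHomIdeal, ← Set.image_univ, MvPolynomial.mem_ideal_span_X_image]
  constructor
  · intro h
    by_contra h0
    obtain ⟨i, -, hi⟩ := h 0 (MvPolynomial.mem_support_iff.2 h0)
    exact hi rfl
  · intro h m hm
    by_contra! hc
    have : m = 0 := Finsupp.ext fun i => hc i trivial
    exact MvPolynomial.mem_support_iff.1 hm (this ▸ h)

theorem maxHomIdeal_ne_top : maxHomIdeal k σ ≠ ⊤ := by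
  rw [Ideal.ne_top_iff_one, mem_maxHomIdeal_iff]
  simp

theorem PaperHTT.IsHomogeneousIdeal.le_maxHomIdeal {I : Ideal (MvPolynomial σ k)}
    (h : IsHomogeneousIdeal k I) (hI : I ≠ ⊤) : I ≤ maxHomIdeal k σ := by
  intro f hf
  rw [mem_maxHomIdeal_iff]
  by_contra h0
  have := h f hf 0
  rw [MvPolynomial.homogeneousComponent_zero] at this
  exact hI (Ideal.eq_top_of_isUnit_mem _ this ((isUnit_iff_ne_zero.2 h0).map MvPolynomial.C))

theorem HasDepth.depthSubQuot_eq {p q : Ideal (MvPolynomial σ k)} {d : ℕ}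
    (h : HasDepth (maxHomIdeal k σ) d (subQuot k p q)) : depthSubQuot k p q = d :=
  h.isLeast.csInf_eq

theorem PaperHTT.IsHomogeneousIdeal.exists_hasDepth [Finite σ] {I : Ideal (MvPolynomial σ k)}
    (h : IsHomogeneousIdeal k I) (h0 : I ≠ ⊥) (h1 : I ≠ ⊤) (n : ℕ) :
    HasDepth (maxHomIdeal k σ) (depthSubQuot k (I ^ n) (I ^ (n + 1))) (assocGr I n) := by
  obtain ⟨d, hd⟩ := (IsGood.of_ideal_ne_bot h0 maxHomIdeal_ne_top
    (h.le_maxHomIdeal h1) n).exists_hasDepth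
  rwa [hd.depthSubQuot_eq]

theorem isTensorAlg_tensorEquivSum :
    IsTensorAlg (MvPolynomial.rename Sum.inl : MvPolynomial σ k →ₐ[k] MvPolynomial (σ ⊕ τ) k)
      (MvPolynomial.rename Sum.inr) (MvPolynomial.tensorEquivSum k σ τ k) := by
  have hl : (MvPolynomial.tensorEquivSum k σ τ k).toAlgHom.comp
      Algebra.TensorProduct.includeLeft = MvPolynomial.rename Sum.inl := by
    ext i; simp
  have hr : ((MvPolynomial.tensorEquivSum k σ τ k).toAlgHom).comp
      Algebra.TensorProduct.includeRight = MvPolynomial.rename Sum.inr := by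
    ext i; simp
  refine ⟨fun a b => ?_⟩
  rw [← hl, ← hr, ← mul_one a, ← one_mul b, ← Algebra.TensorProduct.tmul_mul_tmul, map_mul]
  simp

theorem rename_mem_maxHomIdeal (g : σ → τ) :
    ∀ f ∈ maxHomIdeal k σ, MvPolynomial.rename g f ∈ maxHomIdeal k τ := by
  suffices maxHomIdeal k σ ≤ (maxHomIdeal k τ).comap (MvPolynomial.rename g) from this
  refine Ideal.span_le.2 ?_
  rintro _ ⟨i, rfl⟩
  change MvPolynomial.rename g (MvPolynomial.X i) ∈ maxHomIdeal k τ
  rw [MvPolynomial.rename_X]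
  exact Ideal.subset_span ⟨g i, rfl⟩

theorem maxHomIdeal_sum_le : maxHomIdeal k (σ ⊕ τ) ≤
    (maxHomIdeal k σ).map (MvPolynomial.rename Sum.inl : _ →ₐ[k] MvPolynomial (σ ⊕ τ) k) ⊔
      (maxHomIdeal k τ).map (MvPolynomial.rename Sum.inr : _ →ₐ[k] MvPolynomial (σ ⊕ τ) k) := by
  refine Ideal.span_le.2 ?_
  rintro _ ⟨i | j, rfl⟩
  · refine Ideal.mem_sup_left ?_
    rw [← MvPolynomial.rename_X]
    exact Ideal.mem_map_of_mem _ (Ideal.subset_span ⟨i, rfl⟩)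
  · refine Ideal.mem_sup_right ?_
    rw [← MvPolynomial.rename_X]
    exact Ideal.mem_map_of_mem _ (Ideal.subset_span ⟨j, rfl⟩)

theorem PaperHTT.IsHomogeneousIdeal.depthSubQuot_sumIJ {r s : ℕ} {I : Ideal (PA k r)}
    {J : Ideal (PB k s)}
    (hI0 : I ≠ ⊥) (hI1 : I ≠ ⊤) (hIh : IsHomogeneousIdeal k I)
    (hJ0 : J ≠ ⊥) (hJ1 : J ≠ ⊤) (hJh : IsHomogeneousIdeal k J) {n m : ℕ}
    (hm : IsLeast {d | ∃ i j, i + j = n ∧ depthSubQuot k (I ^ i) (I ^ (i + 1)) +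
      depthSubQuot k (J ^ j) (J ^ (j + 1)) = d} m) :
    depthSubQuot k (sumIJ k I J ^ n) (sumIJ k I J ^ (n + 1)) = m :=
  (isTensorAlg_tensorEquivSum.hasDepth_assocGr (rename_mem_maxHomIdeal _)
    (rename_mem_maxHomIdeal _) maxHomIdeal_sum_le (hIh.exists_hasDepth hI0 hI1)
    (fun i => IsGood.of_ideal_ne_bot hI0 maxHomIdeal_ne_top (hIh.le_maxHomIdeal hI1) i)
    (hJh.exists_hasDepth hJ0 hJ1)
    (fun i => IsGood.of_ideal_ne_bot hJ0 maxHomIdeal_ne_top (hJh.le_maxHomIdeal hJ1) i)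
    (fun i j h => hm.2 ⟨i, j, h, rfl⟩) hm.1).depthSubQuot_eq

end

theorem isLeast_antidiagonal_add_succ {a b : ℕ → ℕ} {p q n m : ℕ} (hp : 1 ≤ p) (hq : 1 ≤ q)
    (ha : ∀ i, p ≤ i + 1 → a i = a (i + 1)) (hb : ∀ j, q ≤ j + 1 → b j = b (j + 1))
    (hn : p + q ≤ n + 2) (hm : IsLeast {d | ∃ i j, i + j = n ∧ a i + b j = d} m) :
    IsLeast {d | ∃ i j, i + j = n + 1 ∧ a i + b j = d} m := by
  constructor
  · obtain ⟨i, j, hij, h⟩ := hm.1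
    rcases le_or_gt p (i + 1) with h' | h'
    · exact ⟨i + 1, j, by omega, by rw [← ha i h', h]⟩
    · exact ⟨i, j + 1, by omega, by rw [← hb j (by omega), h]⟩
  · rintro _ ⟨i, j, hij, rfl⟩
    by_cases h' : p ≤ i
    · obtain ⟨i, rfl⟩ := Nat.exists_eq_add_of_le' (hp.trans h')
      rw [← ha i h']
      exact hm.2 ⟨i, j, by omega, rfl⟩
    · obtain ⟨j, rfl⟩ := Nat.exists_eq_add_of_le' (show 1 ≤ j by omega)
      rw [← hb j (by omega)]
      exact hm.2 ⟨i, j, by omega, rfl⟩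

open PaperHTT in
/-- Corollary 4.3: `s(I+J) ≤ s(I) + s(J) - 1` for the stability indices of the depth
functions of successive quotients of powers. -/
theorem stability_index_sum_le
    (k : Type) [Field k] (r s : ℕ)
    (I : Ideal (PA k r)) (J : Ideal (PB k s))
    (hI0 : I ≠ ⊥) (hI1 : I ≠ ⊤) (hIh : IsHomogeneousIdeal k I)
    (hJ0 : J ≠ ⊥) (hJ1 : J ≠ ⊤) (hJh : IsHomogeneousIdeal k J)
    (sI sJ sQ : ℕ) (hsI1 : 1 ≤ sI) (hsJ1 : 1 ≤ sJ) (hsQ1 : 1 ≤ sQ)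
    (hIstab : ∀ i : ℕ, sI ≤ i → 1 ≤ i →
      depthSubQuot k (I ^ (i - 1)) (I ^ i) = depthSubQuot k (I ^ i) (I ^ (i + 1)))
    (hIleast : ∀ m : ℕ, 1 ≤ m →
      (∀ i : ℕ, m ≤ i → 1 ≤ i →
        depthSubQuot k (I ^ (i - 1)) (I ^ i) = depthSubQuot k (I ^ i) (I ^ (i + 1))) →
      sI ≤ m)
    (hJstab : ∀ i : ℕ, sJ ≤ i → 1 ≤ i →
      depthSubQuot k (J ^ (i - 1)) (J ^ i) = depthSubQuot k (J ^ i) (J ^ (i + 1)))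
    (hJleast : ∀ m : ℕ, 1 ≤ m →
      (∀ i : ℕ, m ≤ i → 1 ≤ i →
        depthSubQuot k (J ^ (i - 1)) (J ^ i) = depthSubQuot k (J ^ i) (J ^ (i + 1))) →
      sJ ≤ m)
    (hQstab : ∀ i : ℕ, sQ ≤ i → 1 ≤ i →
      depthSubQuot k ((sumIJ k I J) ^ (i - 1)) ((sumIJ k I J) ^ i) =
        depthSubQuot k ((sumIJ k I J) ^ i) ((sumIJ k I J) ^ (i + 1)))
    (hQleast : ∀ m : ℕ, 1 ≤ m →
      (∀ i : ℕ, m ≤ i → 1 ≤ i →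
        depthSubQuot k ((sumIJ k I J) ^ (i - 1)) ((sumIJ k I J) ^ i) =
          depthSubQuot k ((sumIJ k I J) ^ i) ((sumIJ k I J) ^ (i + 1))) →
      sQ ≤ m) :
    sQ ≤ sI + sJ - 1 := by
  refine hQleast _ (by omega) fun i hi hi1 => ?_
  obtain ⟨n, rfl⟩ := Nat.exists_eq_add_of_le' hi1
  rw [Nat.add_sub_cancel]
  let S : Set ℕ := {d | ∃ i j, i + j = n ∧ depthSubQuot k (I ^ i) (I ^ (i + 1)) +
      depthSubQuot k (J ^ j) (J ^ (j + 1)) = d}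
  have hS : IsLeast S (sInf S) :=
    ⟨Nat.sInf_mem ⟨_, 0, n, Nat.zero_add n, rfl⟩, fun _ h => Nat.sInf_le h⟩
  rw [IsHomogeneousIdeal.depthSubQuot_sumIJ hI0 hI1 hIh hJ0 hJ1 hJh hS,
    IsHomogeneousIdeal.depthSubQuot_sumIJ hI0 hI1 hIh hJ0 hJ1 hJh
      (isLeast_antidiagonal_add_succ hsI1 hsJ1 (fun i h => hIstab (i + 1) h (by omega))
        (fun j h => hJstab (j + 1) h (by omega)) (by omega) hS)]
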